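/- arXiv:2301.11501 — 2 statements merged into one kernel-verified Lean document; each statement's English description precedes it below -/
import Mathlib

section
/- Let T > 0 and let Δω, T_p, T, ΔT_s be real numbers with 𝒜(Δω) := ∫₀ᵀ e^{iΔω t} dt ≠ 0, let N_p, N_h be natural numbers, and let β ≠ 0 be a complex number. Define S̃_{ihm} and S̃_{(i+1)hm} as in the consecutive-PRT model with equal gains β. If moreover Δω·(T_p + N_p·ΔT_s) ∈ (−π, π] and T_p + N_p·ΔT_s ≠ 0, then arg(S̃_{(i+1)hm} / S̃_{ihm}) = Δω·(T_p + N_p·ΔT_s); in particular the carrier frequency offset is exactly recovered as Δω = arg(S̃_{(i+1)hm}/S̃_{ihm}) / (T_p + N_p·ΔT_s). -/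
open Real

/-- Under waveform design (D1) with equal gains `β ≠ 0` across the two
consecutive PRTs, if `𝒜(Δω) ≠ 0`, `T_p + N_p·ΔT_s ≠ 0` and
`Δω·(T_p + N_p·ΔT_s) ∈ (−π, π]`, then
`arg(S̃_{(i+1)hm}/S̃_{ihm}) = Δω·(T_p + N_p·ΔT_s)`; in particular the carrier frequency
offset is exactly recovered as `Δω = arg(S̃_{(i+1)hm}/S̃_{ihm}) / (T_p + N_p·ΔT_s)`. -/
theorem cfo_exact_recovery (T : ℝ) (hT : 0 < T) (Δω Tp ΔTs : ℝ) (Np Nh : ℕ)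
    (i h : ℕ) (β : ℂ)
    (A : ℂ) (hA : A = ∫ t in (0:ℝ)..T, Complex.exp (Complex.I * ((Δω * t : ℝ) : ℂ)))
    (hAne : A ≠ 0) (hβne : β ≠ 0)
    (Si Si1 : ℂ)
    (hSi : Si = A * β *
        Complex.exp (Complex.I * ((Δω * ((i : ℝ) * Tp + (h : ℝ) * T) : ℝ) : ℂ)) *
        Complex.exp (Complex.I * ((Δω * ((i : ℝ) * (Np : ℝ) + (h : ℝ) * (Nh : ℝ)) * ΔTs : ℝ) : ℂ)))
    (hSi1 : Si1 = A * β *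
        Complex.exp (Complex.I * ((Δω * (((i : ℝ) + 1) * Tp + (h : ℝ) * T) : ℝ) : ℂ)) *
        Complex.exp (Complex.I * ((Δω * (((i : ℝ) + 1) * (Np : ℝ) + (h : ℝ) * (Nh : ℝ)) * ΔTs : ℝ) : ℂ)))
    (hrange : Δω * (Tp + (Np : ℝ) * ΔTs) ∈ Set.Ioc (-π) π)
    (hden : Tp + (Np : ℝ) * ΔTs ≠ 0) :
    Complex.arg (Si1 / Si) = Δω * (Tp + (Np : ℝ) * ΔTs) ∧
      Δω = Complex.arg (Si1 / Si) / (Tp + (Np : ℝ) * ΔTs) := by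
  have hratio : Si1 / Si =
      Complex.exp (((Δω * (Tp + (Np : ℝ) * ΔTs) : ℝ) : ℂ) * Complex.I) := by
    have hne : Si ≠ 0 := by
      rw [hSi]
      exact mul_ne_zero (mul_ne_zero (mul_ne_zero hAne hβne) (Complex.exp_ne_zero _))
        (Complex.exp_ne_zero _)
    rw [div_eq_iff hne, hSi, hSi1, mul_assoc (A * β), mul_assoc (A * β),
      mul_left_comm (Complex.exp _) (A * β), ← Complex.exp_add, ← Complex.exp_add,
      ← Complex.exp_add]
    congr 2
    push_cast
    ring
  have harg : Complex.arg (Si1 / Si) = Δω * (Tp + (Np : ℝ) * ΔTs) := by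
    rw [hratio, Complex.arg_exp_mul_I]
    exact (toIocMod_eq_self Real.two_pi_pos).2 (by rwa [show -π + 2 * π = π by ring])
  exact ⟨harg, by rw [harg, mul_div_cancel_right₀ _ hden]⟩
end

section
/- With all quantities as in the ratio identities, suppose 𝒜(Δω) ≠ 0, the gains β₀, β₁, β₀', β₂ are all nonzero, the front-end stability hypothesis β₁/β₀ = β₂/β₀' holds (so 𝖽_k' = 𝖽_{mk}), and the PSK phase satisfies ϖ ∈ (−π, π]. Then the demodulator output is exactly correct: arg( S̆_{i₂h₂m} / (𝖽_{mk} · 𝒟 · S̃_{i₂hm}) ) = ϖ, where S̆_{i₂h₂m}, S̃_{i₂hm}, 𝖽_{mk}, and 𝒟 are as defined in the context. -/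
open Real

/-- Correctness of the PSK demodulation rule (15) of the paper: with the
Fourier coefficients `S̆_{i₂h₂m}` (hopping frequency `2πk/K`, PSK phase `ϖ`, gain `β₂`)
and `S̃_{i₂hm}` (zero hopping frequency, zero PSK phase, gain `β₀'`), the measured
reference ratio `𝖽_{mk} = 𝒞·(β₁/β₀)·e^{i2πkΔt₀/K}`, and the correction factor `𝒟`:
if `𝒜(Δω) ≠ 0`, the gains `β₀, β₁, β₀', β₂` are all nonzero, the front-end stability
hypothesis `β₁/β₀ = β₂/β₀'` holds, and `ϖ ∈ (−π, π]`, then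
`arg(S̆_{i₂h₂m}/(𝖽_{mk}·𝒟·S̃_{i₂hm})) = ϖ`: the demodulator output is exactly correct. -/
theorem psk_demodulation_correct (T : ℝ) (hT : 0 < T) (Δω Δt0 ΔTs Tp ϖ : ℝ)
    (K : ℕ) (hK : 0 < K) (k : ℕ) (hk1 : 1 ≤ k) (hkK : k ≤ K - 1)
    (Np Nh : ℕ) (i1 i2 h h1 h2 : ℕ) (hh1 : h1 ≠ h) (hh2 : h2 ≠ h)
    (β1 β0 β2 β0' : ℂ)
    (A : ℂ) (hA : A = ∫ t in (0:ℝ)..T, Complex.exp (Complex.I * ((Δω * t : ℝ) : ℂ)))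
    (hAne : A ≠ 0) (hβ0 : β0 ≠ 0) (hβ1 : β1 ≠ 0) (hβ0' : β0' ≠ 0) (hβ2 : β2 ≠ 0)
    (Sb2 St2 C D dmk : ℂ)
    (hSb2 : Sb2 = A * β2 * Complex.exp (Complex.I * ((ϖ : ℝ) : ℂ)) *
        Complex.exp (Complex.I * (((2 * π * (k : ℝ) / (K : ℝ)) *
          (Δt0 + ((i2 : ℝ) * (Np : ℝ) + (h2 : ℝ) * (Nh : ℝ)) * ΔTs) : ℝ) : ℂ)) *
        Complex.exp (Complex.I * ((Δω * ((i2 : ℝ) * Tp + (h2 : ℝ) * T) : ℝ) : ℂ)) *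
        Complex.exp (Complex.I * ((Δω * ((i2 : ℝ) * (Np : ℝ) + (h2 : ℝ) * (Nh : ℝ)) * ΔTs : ℝ) : ℂ)))
    (hSt2 : St2 = A * β0' *
        Complex.exp (Complex.I * ((Δω * ((i2 : ℝ) * Tp + (h : ℝ) * T) : ℝ) : ℂ)) *
        Complex.exp (Complex.I * ((Δω * ((i2 : ℝ) * (Np : ℝ) + (h : ℝ) * (Nh : ℝ)) * ΔTs : ℝ) : ℂ)))
    (hC : C = Complex.exp (Complex.I * ((2 * π * (k : ℝ) *
          ((i1 : ℝ) * (Np : ℝ) + (h1 : ℝ) * (Nh : ℝ)) * ΔTs / (K : ℝ) : ℝ) : ℂ)) *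
        Complex.exp (Complex.I * ((Δω * ((h1 : ℝ) - (h : ℝ)) * T : ℝ) : ℂ)) *
        Complex.exp (Complex.I * ((Δω * ((h1 : ℝ) - (h : ℝ)) * (Nh : ℝ) * ΔTs : ℝ) : ℂ)))
    (hdmk : dmk = C * (β1 / β0) *
        Complex.exp (Complex.I * ((2 * π * (k : ℝ) * Δt0 / (K : ℝ) : ℝ) : ℂ)))
    (hD : D = Complex.exp (Complex.I * ((2 * π * (k : ℝ) *
          (((i2 : ℝ) - (i1 : ℝ)) * (Np : ℝ) + ((h2 : ℝ) - (h1 : ℝ)) * (Nh : ℝ)) * ΔTs / (K : ℝ) : ℝ) : ℂ)) *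
        Complex.exp (Complex.I * ((Δω * ((h2 : ℝ) - (h1 : ℝ)) * T : ℝ) : ℂ)) *
        Complex.exp (Complex.I * ((Δω * ((h2 : ℝ) - (h1 : ℝ)) * (Nh : ℝ) * ΔTs : ℝ) : ℂ)))
    (hstable : β1 / β0 = β2 / β0')
    (hϖ : ϖ ∈ Set.Ioc (-π) π) :
    Complex.arg (Sb2 / (dmk * D * St2)) = ϖ := by
  have hratio : Sb2 = Complex.exp (ϖ * Complex.I) * (dmk * D * St2) := by
    rw [hSb2, hdmk, hD, hSt2, hC, hstable]
    have hphase : ∀ x y z x₁ y₁ z₁ t x₂ y₂ z₂ u v : ℝ,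
        x + y + z = x₁ + y₁ + z₁ + t + x₂ + y₂ + z₂ + u + v →
        A * β2 * Complex.exp (Complex.I * (ϖ : ℂ)) * Complex.exp (Complex.I * (x : ℂ)) *
            Complex.exp (Complex.I * (y : ℂ)) * Complex.exp (Complex.I * (z : ℂ)) =
          Complex.exp (ϖ * Complex.I) *
            (Complex.exp (Complex.I * (x₁ : ℂ)) * Complex.exp (Complex.I * (y₁ : ℂ)) *
                Complex.exp (Complex.I * (z₁ : ℂ)) * (β2 / β0') *
                Complex.exp (Complex.I * (t : ℂ)) *
              (Complex.exp (Complex.I * (x₂ : ℂ)) * Complex.exp (Complex.I * (y₂ : ℂ)) *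
                Complex.exp (Complex.I * (z₂ : ℂ))) *
              (A * β0' * Complex.exp (Complex.I * (u : ℂ)) *
                Complex.exp (Complex.I * (v : ℂ)))) := by
      intro x y z x₁ y₁ z₁ t x₂ y₂ z₂ u v hsum
      have hexp : Complex.exp (Complex.I * ((x + y + z : ℝ) : ℂ)) =
          Complex.exp (Complex.I * ((x₁ + y₁ + z₁ + t + x₂ + y₂ + z₂ + u + v : ℝ) : ℂ)) := by
        rw [hsum]
      simp only [Complex.ofReal_add, mul_add, Complex.exp_add] at hexp
      rw [mul_comm (ϖ : ℂ) Complex.I]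
      field_simp
      linear_combination hexp
    apply hphase
    ring
  have hne : dmk * D * St2 ≠ 0 := by
    rw [hdmk, hD, hSt2, hC]
    simp [Complex.exp_ne_zero, hAne, hβ0, hβ1, hβ0']
  rw [hratio, mul_div_cancel_right₀ _ hne, Complex.arg_exp_mul_I, toIocMod_eq_self]
  simpa [two_mul] using hϖ
end
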